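/- Let k be an even integer and let f be a function on the upper half-plane with real Fourier coefficients (so conj(f(z)) = f(−z̄)) satisfying the modular transformation f(z/(4z+1)) = (4z+1)^k f(z). Then for z = -1/4 + (1/4)e^{iθ} with 0 < θ < π, the quantity e^{ikθ/2} f(z) is real. -/

import Mathlib

open Complex Real

/-- On the circle `z = -1/4 + e^{iθ}/4`, the map `z ↦ z / (4z + 1)` agrees with `z ↦ -z̄`. -/
theorem div_four_mul_add_one_eq_neg_conj (θ : ℝ) (z : ℂ)
    (hz : z = -(1/4) + (1/4) * Complex.exp (I * θ)) :
    z / (4 * z + 1) = -(starRingEnd ℂ) z := by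
  have hne := Complex.exp_ne_zero (I * θ)
  have hden : 4 * z + 1 = Complex.exp (I * θ) := by rw [hz]; ring
  have hc : (starRingEnd ℂ) (Complex.exp (I * θ)) = (Complex.exp (I * θ))⁻¹ := by
    rw [← Complex.exp_conj, ← Complex.exp_neg]
    simp
  rw [hden, hz]
  simp only [map_add, map_neg, map_mul, map_div₀, map_one, map_ofNat, hc]
  field_simp
  ring

theorem weighted_form_real_on_arc (k : ℤ) (hk : Even k) (f : ℂ → ℂ)
    (hconj : ∀ z : ℂ, 0 < z.im → (starRingEnd ℂ) (f z) = f (-(starRingEnd ℂ) z))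
    (hmod : ∀ z : ℂ, 0 < z.im → f (z / (4 * z + 1)) = (4 * z + 1) ^ k * f z)
    (θ : ℝ) (hθ0 : 0 < θ) (hθπ : θ < π)
    (z : ℂ) (hz : z = -(1/4) + (1/4) * Complex.exp (I * θ)) :
    (Complex.exp (I * k * θ / 2) * f z).im = 0 := by
  have him : 0 < z.im := by
    have : z.im = Real.sin θ / 4 := by
      have hre : (1/4 : ℂ) = ((1/4 : ℝ) : ℂ) := by norm_num
      rw [hz, mul_comm I, hre, Complex.add_im, Complex.neg_im, Complex.ofReal_im,
        Complex.im_ofReal_mul, Complex.exp_ofReal_mul_I_im]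
      ring
    rw [this]
    linarith [Real.sin_pos_of_pos_of_lt_pi hθ0 hθπ]
  have hden : 4 * z + 1 = Complex.exp (I * θ) := by rw [hz]; ring
  have hfz : (starRingEnd ℂ) (f z) = Complex.exp (k * (I * θ)) * f z := by
    rw [hconj z him, ← div_four_mul_add_one_eq_neg_conj θ z hz, hmod z him, hden,
      Complex.exp_int_mul]
  rw [← Complex.conj_eq_iff_im, map_mul, hfz, ← Complex.exp_conj, ← mul_assoc, ← Complex.exp_add]
  congr 2
  simp only [map_div₀, map_mul, conj_I, conj_ofReal, map_intCast, map_ofNat]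
  ring
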